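/- Double selector failure, a single-SP-supported row is an incomplete-SP row with high probability: let μ be the product Bernoulli(q) measure on Fin N → Fin N → Bool with N ≥ 2, 0 < q < 1. Fix φ = {(i,j),(i',j')} with i ≠ i', j ≠ j', and m ∉ {i,i'}. Then the conditional probability, given the event {X i j = true ∧ X i' j' = true ∧ X m j = true ∧ X m j' = false} (both SFs active, row m single-SP-supported), that row m is an incomplete-SP row is at least 1 − 2(1 − q(1−q)²)^{N−2}. -/

import Mathlib

open MeasureTheory

/-- Bernoulli(q) measure on `Bool`: `true` has probability `q`. -/
noncomputable def bern (q : ℝ) : Measure Bool :=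
  (ENNReal.ofReal q) • Measure.dirac true + (ENNReal.ofReal (1 - q)) • Measure.dirac false

instance (q : ℝ) : IsFiniteMeasure (bern q) := by
  constructor
  simp [bern, Measure.add_apply, Measure.smul_apply]

/-- Product measure on `Fin N → Fin N → Bool` making the `N²` entries i.i.d. Bernoulli(q). -/
noncomputable def arrMeasure (N : ℕ) (q : ℝ) : Measure (Fin N → Fin N → Bool) :=
  Measure.pi fun _ => Measure.pi fun _ => bern q

/-- Cell `(m,n)` is an SP cell for the double-SF set `{(i,j),(i',j')}` (both active). -/
def IsSPCellDouble (N : ℕ) (X : Fin N → Fin N → Bool)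
    (i i' j j' m n : Fin N) : Prop :=
  X m n = false ∧
    ((X i n = true ∧ X m j = true) ∨ (X i' n = true ∧ X m j' = true))

/-- Row `m` is an incomplete-SP row: it contains an SP cell together with a critical
cell `(m,n)`, `n ∉ {j,j'}`, holding a logical 0 that is not an SP cell. -/
def IsIncompleteSPRow (N : ℕ) (X : Fin N → Fin N → Bool)
    (i i' j j' m : Fin N) : Prop :=
  (∃ n : Fin N, IsSPCellDouble N X i i' j j' m n) ∧
  ∃ n : Fin N, n ≠ j ∧ n ≠ j' ∧
    (X m j = true ∨ X m j' = true) ∧ (X i n = true ∨ X i' n = true) ∧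
    X m n = false ∧ ¬ IsSPCellDouble N X i i' j j' m n


instance bern_prob (q : ℝ) [h : Fact (0 < q ∧ q < 1)] : IsProbabilityMeasure (bern q) := by
  constructor
  have h1 := h.out.1
  have h2 := h.out.2
  simp only [bern, Measure.add_apply, Measure.smul_apply, measure_univ, smul_eq_mul, mul_one]
  rw [← ENNReal.ofReal_add h1.le (by linarith)]
  simp

theorem bern_true (q : ℝ) : bern q {true} = ENNReal.ofReal q := by
  simp [bern]

theorem bern_false (q : ℝ) : bern q {false} = ENNReal.ofReal (1 - q) := by
  simp [bern]

theorem bern_ne_zero (q : ℝ) (h0 : 0 < q) (h1 : q < 1) (b : Bool) : bern q {b} ≠ 0 := by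
  cases b
  · rw [bern_false]; simpa using h1
  · rw [bern_true]; simpa using h0

theorem arr_singleton (N : ℕ) (q : ℝ) (X : Fin N → Fin N → Bool) :
    arrMeasure N q {X} = ∏ a, ∏ b, bern q {X a b} := by
  unfold arrMeasure
  rw [Measure.pi_singleton]
  simp only [Measure.pi_singleton]

theorem arr_swap (N : ℕ) (q : ℝ) :
    arrMeasure N q = (arrMeasure N q).map (fun Y a b => Y b a) := by
  apply Measure.ext_of_singleton
  intro X
  rw [Measure.map_apply (measurable_of_countable _) (measurableSet_singleton _)]
  have : (fun (Y : Fin N → Fin N → Bool) a b => Y b a) ⁻¹' {X} = {fun a b => X b a} := by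
    ext Y
    simp only [Set.mem_preimage, Set.mem_singleton_iff]
    constructor
    · rintro rfl; rfl
    · rintro rfl; rfl
  rw [this, arr_singleton, arr_singleton, Finset.prod_comm]

theorem arr_cols (N : ℕ) (q : ℝ) (S : Fin N → Set (Fin N → Bool)) :
    arrMeasure N q {X | ∀ n, (fun a => X a n) ∈ S n}
      = ∏ n, (Measure.pi fun _ : Fin N => bern q) (S n) := by
  rw [arr_swap, Measure.map_apply (measurable_of_countable _) (Set.toFinite _).measurableSet]
  rw [← Measure.pi_pi]
  unfold arrMeasure
  congr 1
  ext Y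
  simp [Set.mem_pi]

theorem col_three (N : ℕ) (q : ℝ) [Fact (0 < q ∧ q < 1)] (m i i' : Fin N)
    (hii : i ≠ i') (hmi : m ≠ i) (hmi' : m ≠ i') (a b c : Bool) :
    (Measure.pi fun _ : Fin N => bern q) {y | y m = a ∧ y i = b ∧ y i' = c}
      = bern q {a} * bern q {b} * bern q {c} := by
  have h : {y : Fin N → Bool | y m = a ∧ y i = b ∧ y i' = c} =
      Set.pi Set.univ (fun k => if k = m then {a} else if k = i then {b}
        else if k = i' then {c} else Set.univ) := by
    ext y
    simp only [Set.mem_setOf_eq, Set.mem_pi, Set.mem_univ, true_implies]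
    constructor
    · rintro ⟨h1, h2, h3⟩ k
      split_ifs with e1 e2 e3
      · subst e1; exact h1
      · subst e2; exact h2
      · subst e3; exact h3
      · trivial
    · intro h
      refine ⟨?_, ?_, ?_⟩
      · simpa using h m
      · simpa [hmi.symm] using h i
      · simpa [hmi'.symm, hii.symm] using h i'
  rw [h, Measure.pi_pi]
  have h2 : ∀ k : Fin N, bern q (if k = m then {a} else if k = i then {b}
        else if k = i' then {c} else Set.univ) =
      (if k = m then bern q {a} else 1) * (if k = i then bern q {b} else 1) *
      (if k = i' then bern q {c} else 1) := by
    intro k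
    by_cases e1 : k = m
    · subst e1; simp [hmi, hmi']
    · by_cases e2 : k = i
      · subst e2; simp [e1, hii]
      · by_cases e3 : k = i'
        · subst e3; simp [e1, e2]
        · rw [if_neg e1, if_neg e2, if_neg e3, if_neg e1, if_neg e2, if_neg e3, measure_univ]
          simp
  simp only [h2, Finset.prod_mul_distrib, Finset.prod_ite_eq', Finset.prod_ite_eq,
    Finset.mem_univ, if_true]

theorem arr_cond (N : ℕ) (q : ℝ) [Fact (0 < q ∧ q < 1)] (i i' j j' m : Fin N)
    (hjj : j ≠ j') (U : Set (Fin N → Bool)) :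
    arrMeasure N q {X | (∀ n, n ≠ j → n ≠ j' → (fun a => X a n) ∈ U) ∧
        (X i j = true ∧ X i' j' = true ∧ X m j = true ∧ X m j' = false)}
      = (Measure.pi fun _ : Fin N => bern q) {y | y i = true ∧ y m = true} *
        (Measure.pi fun _ : Fin N => bern q) {y | y i' = true ∧ y m = false} *
        (Measure.pi fun _ : Fin N => bern q) U ^ (N - 2) := by
  have h : {X : Fin N → Fin N → Bool | (∀ n, n ≠ j → n ≠ j' → (fun a => X a n) ∈ U) ∧
        (X i j = true ∧ X i' j' = true ∧ X m j = true ∧ X m j' = false)} =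
      {X | ∀ n, (fun a => X a n) ∈ (if n = j then {y | y i = true ∧ y m = true}
        else if n = j' then {y | y i' = true ∧ y m = false} else U :
          Set (Fin N → Bool))} := by
    ext X
    simp only [Set.mem_setOf_eq]
    constructor
    · rintro ⟨h0, h1, h2, h3, h4⟩ n
      split_ifs with e1 e2
      · subst e1; exact ⟨h1, h3⟩
      · subst e2; exact ⟨h2, h4⟩
      · exact h0 n e1 e2
    · intro h
      have hj := h j
      have hj' := h j'
      rw [if_pos rfl] at hj
      rw [if_neg hjj.symm, if_pos rfl] at hj'
      refine ⟨fun n e1 e2 => ?_, hj.1, hj'.1, hj.2, hj'.2⟩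
      have := h n
      rwa [if_neg e1, if_neg e2] at this
  rw [h, arr_cols]
  rw [← Finset.mul_prod_erase _ _ (Finset.mem_univ j),
    ← Finset.mul_prod_erase _ _ (Finset.mem_erase.2 ⟨hjj.symm, Finset.mem_univ j'⟩),
    if_pos rfl, if_neg hjj.symm, if_pos rfl, ← mul_assoc]
  congr 1
  rw [Finset.prod_congr rfl (g := fun _ => (Measure.pi fun _ : Fin N => bern q) U)]
  · rw [Finset.prod_const, Finset.card_erase_of_mem
      (Finset.mem_erase.2 ⟨hjj.symm, Finset.mem_univ j'⟩),
      Finset.card_erase_of_mem (Finset.mem_univ j)]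
    simp [Nat.sub_sub]
  · intro n hn
    simp only [Finset.mem_erase, Finset.mem_univ, and_true] at hn
    rw [if_neg hn.2, if_neg hn.1]

/-- Double selector failure: conditioned on both SFs being active and
row `m ∉ {i,i'}` being single-SP-supported (`X m j = true`, `X m j' = false`),
row `m` is an incomplete-SP row with probability at least
`1 − 2(1 − q(1−q)²)^{N−2}`. -/
theorem double_sf_single_supported_row_is_incomplete_prob
    (N : ℕ) (hN : 2 ≤ N) (q : ℝ) (hq0 : 0 < q) (hq1 : q < 1)
    (i i' j j' m : Fin N)
    (hii : i ≠ i') (hjj : j ≠ j') (hmi : m ≠ i) (hmi' : m ≠ i') :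
    (arrMeasure N q) ({X : Fin N → Fin N → Bool | IsIncompleteSPRow N X i i' j j' m} ∩
      {X : Fin N → Fin N → Bool |
        X i j = true ∧ X i' j' = true ∧ X m j = true ∧ X m j' = false})
      / (arrMeasure N q) {X : Fin N → Fin N → Bool |
        X i j = true ∧ X i' j' = true ∧ X m j = true ∧ X m j' = false}
    ≥ ENNReal.ofReal (1 - 2 * (1 - q * (1 - q) ^ 2) ^ (N - 2)) := by
  haveI : Fact (0 < q ∧ q < 1) := ⟨⟨hq0, hq1⟩⟩
  set E := {X : Fin N → Fin N → Bool |
        X i j = true ∧ X i' j' = true ∧ X m j = true ∧ X m j' = false} with hE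
  set I := {X : Fin N → Fin N → Bool | IsIncompleteSPRow N X i i' j j' m} with hI
  set μ := arrMeasure N q with hμ
  haveI : IsProbabilityMeasure μ := by rw [hμ]; unfold arrMeasure; infer_instance
  let T : Bool → Bool → Set (Fin N → Bool) :=
    fun b c => {y | y m = false ∧ y i = b ∧ y i' = c}
  let A : Bool → Bool → Set (Fin N → Fin N → Bool) := fun b c =>
    {X | (∀ n, n ≠ j → n ≠ j' → (fun a => X a n) ∈ (T b c)ᶜ) ∧
        (X i j = true ∧ X i' j' = true ∧ X m j = true ∧ X m j' = false)}
  have hr0 : 0 ≤ 1 - q * (1 - q) ^ 2 := by nlinarith [sq_nonneg (1 - q), mul_pos hq0 (sub_pos.2 hq1)]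
  have hUc : ∀ b c, bern q {b} * bern q {c} = ENNReal.ofReal (q * (1 - q)) →
      μ (A b c) = μ E * ENNReal.ofReal ((1 - q * (1 - q) ^ 2) ^ (N - 2)) := by
    intro b c hbc
    have e1 := arr_cond N q i i' j j' m hjj (T b c)ᶜ
    have e2 := arr_cond N q i i' j j' m hjj Set.univ
    have e3 : μ E = _ := (congrArg _ (by ext X; simp [hE])).trans e2
    rw [e3, measure_univ, one_pow, mul_one, ENNReal.ofReal_pow hr0]
    refine e1.trans ?_
    congr 2
    rw [prob_compl_eq_one_sub (Set.toFinite _).measurableSet,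
      col_three N q m i i' hii hmi hmi', mul_assoc, hbc, bern_false,
      ← ENNReal.ofReal_mul (by linarith), ← ENNReal.ofReal_one,
      ← ENNReal.ofReal_sub _ (by have := sub_pos.2 hq1; positivity)]
    congr 1
    ring
  have hA := hUc true false (by rw [bern_true, bern_false, ENNReal.ofReal_mul hq0.le])
  have hB := hUc false true (by
    rw [bern_true, bern_false, mul_comm, ENNReal.ofReal_mul hq0.le])
  have hsub : E ⊆ (I ∩ E) ∪ (A true false ∪ A false true) := by
    intro X hX
    by_contra hcon
    simp only [Set.mem_union, not_or] at hcon
    obtain ⟨h1, h2, h3⟩ := hcon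
    have h2' : ¬ ∀ n, n ≠ j → n ≠ j' → (fun a => X a n) ∈ (T true false)ᶜ :=
      fun h => h2 ⟨h, hX⟩
    have h3' : ¬ ∀ n, n ≠ j → n ≠ j' → (fun a => X a n) ∈ (T false true)ᶜ :=
      fun h => h3 ⟨h, hX⟩
    simp only [not_forall, Set.mem_compl_iff, not_not] at h2' h3'
    obtain ⟨n, -, -, hn1, hn2, -⟩ := h2'
    obtain ⟨k, hkj, hkj', hk1, hk2, hk3⟩ := h3'
    obtain ⟨x1, x2, x3, x4⟩ := hX
    apply h1
    refine ⟨⟨⟨n, hn1, Or.inl ⟨hn2, x3⟩⟩, k, hkj, hkj', Or.inl x3, Or.inr hk3, hk1, ?_⟩,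
      x1, x2, x3, x4⟩
    rintro ⟨-, ⟨h, -⟩ | ⟨-, h⟩⟩
    · simp only at hk2
      rw [hk2] at h; exact absurd h (by simp)
    · rw [x4] at h; exact absurd h (by simp)
  have hE0 : μ E ≠ 0 := by
    intro h0
    have hmem : (fun a b => if a = m ∧ b = j' then false else true) ∈ E := by
      simp [hE, hmi.symm, hmi'.symm, hjj]
    have := measure_mono_null (Set.singleton_subset_iff.2 hmem) h0
    rw [hμ, arr_singleton] at this
    simp only [Finset.prod_eq_zero_iff] at this
    obtain ⟨a, -, b, -, h⟩ := this
    exact bern_ne_zero q hq0 hq1 _ h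
  set r := (1 - q * (1 - q) ^ 2) ^ (N - 2) with hr
  have hr0' : 0 ≤ r := pow_nonneg hr0 _
  have key : μ E ≤ μ (I ∩ E) + (μ E * ENNReal.ofReal r + μ E * ENNReal.ofReal r) := by
    calc μ E ≤ _ := measure_mono hsub
      _ ≤ μ (I ∩ E) + μ (A true false ∪ A false true) := measure_union_le _ _
      _ ≤ μ (I ∩ E) + (μ (A true false) + μ (A false true)) := by
        gcongr; exact measure_union_le _ _
      _ = _ := by rw [hA, hB]
  rw [ge_iff_le, ENNReal.le_div_iff_mul_le (Or.inl hE0) (Or.inl (measure_ne_top _ _)),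
    ENNReal.ofReal_sub _ (by positivity), ENNReal.ofReal_one,
    ENNReal.sub_mul (fun _ _ => measure_ne_top _ _), one_mul, tsub_le_iff_right]
  refine key.trans (le_of_eq ?_)
  rw [two_mul, ENNReal.ofReal_add hr0' hr0', add_mul, mul_comm (μ E)]
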